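/- Let K be a field, n ≥ 1 an integer, and K' = K(X_0, …, X_{n−1}) the field of fractions of the polynomial ring in n indeterminates over K. Let p = T^n + X_{n−1}T^{n−1} + … + X_1 T + X_0 ∈ K'[T] be the generic monic polynomial of degree n. Then p is irreducible over K', and the field A' = K'[T]/(p) has no K'-subalgebras other than K' and A'. -/

import Mathlib

open Polynomial in
/-- The degree of a nonzero polynomial is at least the size of any injective family of roots. -/
lemma card_le_natDegree_of_injective_roots {L ι : Type*} [Field L] [Fintype ι] {y : ι → L}
    (hy : Function.Injective y) {q : L[X]} (hq : q ≠ 0) (h : ∀ i, q.IsRoot (y i)) :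
    Fintype.card ι ≤ q.natDegree := by
  classical
  rw [← Finset.card_univ, ← Finset.card_image_of_injective _ hy]
  refine Polynomial.card_le_degree_of_subset_roots fun a ha ↦ ?_
  obtain ⟨i, -, rfl⟩ := Finset.mem_image.mp ha
  exact (mem_roots hq).mpr (h i)

open Polynomial in
/-- A monic polynomial with distinct roots which are permuted transitively by endomorphisms of
an overfield is irreducible. -/
lemma irreducible_of_transitive_roots {F L ι : Type*} [Field F] [Field L] [Fintype ι]
    {p : F[X]} (hp : p.Monic) (j : F →+* L) {y : ι → L} (hy : Function.Injective y)
    (hpy : p.map j = ∏ i, (X - C (y i))) (i₀ : ι)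
    (hφ : ∀ i, ∃ φ : L →+* L, φ.comp j = j ∧ φ (y i₀) = y i) :
    Irreducible p := by
  let := j.toAlgebra
  have hroot : aeval (y i₀) p = 0 := by
    rw [aeval_def, ← eval_map]
    exact (congrArg (eval (y i₀)) hpy).trans
      (by rw [eval_prod]; exact Finset.prod_eq_zero (Finset.mem_univ i₀) (by simp))
  have hint : IsIntegral F (y i₀) := ⟨p, hp, hroot⟩
  have hdeg : p.natDegree = Fintype.card ι := by
    rw [← natDegree_map j, hpy, natDegree_prod_of_monic _ _ fun i _ ↦ monic_X_sub_C _]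
    simp
  have hroots : ∀ i, ((minpoly F (y i₀)).map j).IsRoot (y i) := fun i ↦ by
    obtain ⟨φ, hφj, hφy⟩ := hφ i
    have h : eval₂ j (y i₀) (minpoly F (y i₀)) = 0 := minpoly.aeval F (y i₀)
    have h2 := congrArg φ h
    rw [hom_eval₂, hφj, hφy, map_zero] at h2
    rwa [IsRoot, eval_map]
  have hle := card_le_natDegree_of_injective_roots hy
    ((minpoly.monic hint).map j).ne_zero hroots
  rw [natDegree_map, ← hdeg] at hle
  rw [eq_of_monic_of_dvd_of_natDegree_le (minpoly.monic hint) hp (minpoly.dvd F _ hroot) hle]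
  exact minpoly.irreducible hint

open Polynomial in
/-- If the stabilizer of one root acts transitively on the other (distinct) roots of `p`, then
adjoining a root of `p` is an extension without proper intermediate extensions. -/
lemma subalgebra_adjoinRoot_eq_bot_or_eq_top {F L ι : Type*} [Field F] [Field L] [Fintype ι]
    {p : F[X]} (hirr : Irreducible p) (j : F →+* L) {y : ι → L} (hy : Function.Injective y)
    (hpy : p.map j = ∏ i, (X - C (y i))) (i₀ : ι)
    (hφ : ∀ i k, i ≠ i₀ → k ≠ i₀ →
      ∃ φ : L →+* L, φ.comp j = j ∧ φ (y i₀) = y i₀ ∧ φ (y i) = y k)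
    (S : Subalgebra F (AdjoinRoot p)) : S = ⊥ ∨ S = ⊤ := by
  have : Fact (Irreducible p) := ⟨hirr⟩
  have hdeg : p.natDegree = Fintype.card ι := by
    rw [← natDegree_map j, hpy, natDegree_prod_of_monic _ _ fun i _ ↦ monic_X_sub_C _]
    simp
  have : FiniteDimensional F (AdjoinRoot p) := (AdjoinRoot.powerBasis hirr.ne_zero).finite
  have hfin : Module.finrank F (AdjoinRoot p) = Fintype.card ι := by
    rw [(AdjoinRoot.powerBasis hirr.ne_zero).finrank, AdjoinRoot.powerBasis_dim, hdeg]
  obtain ⟨E, rfl⟩ : ∃ E : IntermediateField F (AdjoinRoot p), E.toSubalgebra = S :=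
    ⟨S.toIntermediateField fun x hx ↦ S.inv_mem_of_algebraic (x := ⟨x, hx⟩)
      (Algebra.IsAlgebraic.isAlgebraic _), rfl⟩
  set t := AdjoinRoot.root p with ht
  have hroot : eval₂ j (y i₀) p = 0 := by
    rw [← eval_map, hpy, eval_prod]
    exact Finset.prod_eq_zero (Finset.mem_univ i₀) (by simp)
  let ψ : AdjoinRoot p →+* L := AdjoinRoot.lift j (y i₀) hroot
  have hψt : ψ t = y i₀ := AdjoinRoot.lift_root hroot
  have hψj : ψ.comp (algebraMap F (AdjoinRoot p)) = j := by
    ext a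
    exact AdjoinRoot.lift_of hroot
  let e : E →+* L := ψ.comp (algebraMap E (AdjoinRoot p))
  have hint : IsIntegral E t := Algebra.IsIntegral.isIntegral t
  have hmonic := (minpoly.monic hint).map e
  have hdvd : (minpoly E t).map e ∣ ∏ i, (X - C (y i)) := by
    have h : minpoly E t ∣ p.map (algebraMap F E) := minpoly.dvd _ _ (by
      rw [aeval_map_algebraMap, ht, AdjoinRoot.aeval_eq, AdjoinRoot.mk_self])
    have h2 := Polynomial.map_dvd e h
    rw [Polynomial.map_map] at h2
    rwa [show e.comp (algebraMap F E) = j from hψj, hpy] at h2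
  have hroots_mem : ∀ a, ((minpoly E t).map e).IsRoot a → ∃ i, y i = a := fun a ha ↦ by
    have := ha.dvd hdvd
    rw [IsRoot, eval_prod, Finset.prod_eq_zero_iff] at this
    obtain ⟨i, -, hi⟩ := this
    exact ⟨i, by simpa [sub_eq_zero, eq_comm] using hi⟩
  have hroot₀ : ((minpoly E t).map e).IsRoot (y i₀) := by
    rw [IsRoot, eval_map, ← hψt, ← hom_eval₂]
    exact (congrArg ψ (minpoly.aeval E t)).trans (map_zero ψ)
  have hsep : (∏ i, (X - C (y i))).Separable := separable_prod_X_sub_C_iff.mpr hy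
  have hsplits : ((minpoly E t).map e).Splits :=
    (Splits.prod fun i _ ↦ Splits.X_sub_C (y i)).of_dvd hsep.ne_zero hdvd
  by_cases h : ∃ i, i ≠ i₀ ∧ ((minpoly E t).map e).IsRoot (y i)
  · left
    obtain ⟨i, hi, hri⟩ := h
    have hall : ∀ k, ((minpoly E t).map e).IsRoot (y k) := fun k ↦ by
      by_cases hk : k = i₀
      · rwa [hk]
      obtain ⟨φ, hφj, hφ₀, hφi⟩ := hφ i k hi hk
      have hφψ : φ.comp ψ = ψ := AdjoinRoot.ringHom_ext
        (by
          change (φ.comp (ψ.comp (algebraMap F (AdjoinRoot p)))) =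
            ψ.comp (algebraMap F (AdjoinRoot p))
          rw [hψj, hφj])
        (by change φ (ψ t) = ψ t; rw [hψt, hφ₀])
      have hφe : φ.comp e = e := by
        change (φ.comp ψ).comp _ = _
        rw [hφψ]
      rw [IsRoot, eval_map] at hri ⊢
      rw [← hφi, ← hφe, ← hom_eval₂, hri, map_zero]
    have hle := card_le_natDegree_of_injective_roots hy hmonic.ne_zero hall
    rw [natDegree_map] at hle
    have hmul := Module.finrank_mul_finrank F E (AdjoinRoot p)
    have hEle := minpoly.natDegree_le (A := E) t
    have hpos : 0 < Module.finrank F E := Module.finrank_pos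
    have hpos' : 0 < Module.finrank E (AdjoinRoot p) := Module.finrank_pos
    have h1 : Module.finrank F E = 1 := by
      rw [hfin] at hmul
      nlinarith
    rw [IntermediateField.finrank_eq_one_iff.mp h1, IntermediateField.bot_toSubalgebra]
  · right
    push Not at h
    have hle : (minpoly E t).natDegree ≤ 1 := by
      rw [← natDegree_map e, hsplits.natDegree_eq_card_roots]
      have hnd : ((minpoly E t).map e).roots.Nodup := nodup_roots (hsep.of_dvd hdvd)
      refine (Multiset.card_le_card (t := {y i₀}) <| (Multiset.le_iff_subset hnd).mpr
        fun a ha ↦ ?_).trans_eq (Multiset.card_singleton _)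
      have har := isRoot_of_mem_roots ha
      obtain ⟨i, rfl⟩ := hroots_mem a har
      rw [Multiset.mem_singleton]
      by_contra hne
      exact h i (fun hi ↦ hne (by rw [hi])) har
    have hmem : t ∈ E := by
      obtain ⟨x, hx⟩ := minpoly.natDegree_eq_one_iff.mp
        (le_antisymm hle (minpoly.natDegree_pos hint))
      rw [← hx]
      exact x.2
    rw [eq_top_iff, ← AdjoinRoot.adjoinRoot_eq_top, Algebra.adjoin_le_iff,
      Set.singleton_subset_iff]
    exact hmem

namespace MvPolynomial

variable (K : Type*) [Field K] (n : ℕ)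

/-- The specialization of the coefficients `X_i` of the generic monic polynomial of degree `n` to
those of `∏ (T + Y_j)`. -/
noncomputable def genericCoeffHom : MvPolynomial (Fin n) K →ₐ[K] MvPolynomial (Fin n) K :=
  aeval fun i : Fin n ↦ esymm (Fin n) K (n - i)

lemma genericCoeffHom_injective : Function.Injective (genericCoeffHom K n) := by
  have h : genericCoeffHom K n =
      ((symmetricSubalgebra (Fin n) K).val.comp (esymmAlgHom (Fin n) K n)).comp
        (rename Fin.rev) := by
    ext i : 1
    have hi : n - (i : ℕ) = n - (i + 1) + 1 := by omega
    simp [genericCoeffHom, esymmAlgHom, hi]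
  rw [h]
  exact (Subtype.val_injective.comp (esymmAlgHom_injective K (by simp))).comp
    (rename_injective _ Fin.rev_injective)

lemma rename_comp_genericCoeffHom (σ : Equiv.Perm (Fin n)) :
    (rename σ).comp (genericCoeffHom K n) = genericCoeffHom K n := by
  ext i : 1
  simp [genericCoeffHom, rename_esymm]

lemma X_pow_add_sum_esymm_eq_prod :
    (Polynomial.X ^ n + ∑ i : Fin n, Polynomial.C (esymm (Fin n) K (n - i)) *
      Polynomial.X ^ (i : ℕ)) =
    ∏ i : Fin n, (Polynomial.X + Polynomial.C (X i : MvPolynomial (Fin n) K)) := by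
  rw [prod_C_add_X_eq_sum_esymm, Fintype.card_fin, ← Finset.sum_range_reflect,
    Finset.sum_range_succ, add_comm,
    Finset.sum_range fun i ↦ Polynomial.C (esymm (Fin n) K (n + 1 - 1 - i)) *
      Polynomial.X ^ (n - (n + 1 - 1 - i))]
  congr 1
  · refine Finset.sum_congr rfl fun i _ ↦ ?_
    have hi : n - (n - (i : ℕ)) = i := by omega
    simp [hi]
  · simp

end MvPolynomial

open MvPolynomial in
/-- Over any fraction field `K'` of `K[X_0, …, X_{n-1}]`, the generic monic polynomial `p` of degree
`n ≥ 1` is irreducible, and `K'[T]/(p)` has only the two trivial `K'`-subalgebras. -/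
lemma irreducible_and_subalgebra_of_generic (K : Type*) [Field K] (n : ℕ) (hn : 1 ≤ n)
    (K' : Type*) [Field K'] [Algebra (MvPolynomial (Fin n) K) K']
    [IsFractionRing (MvPolynomial (Fin n) K) K'] (p : Polynomial K')
    (hpdef : p = Polynomial.X ^ n + ∑ i : Fin n, Polynomial.C
      (algebraMap (MvPolynomial (Fin n) K) K' (X i)) * Polynomial.X ^ (i : ℕ)) :
    Irreducible p ∧ ∀ S : Subalgebra K' (AdjoinRoot p), S = ⊥ ∨ S = ⊤ := by
  let ι := algebraMap (MvPolynomial (Fin n) K) K'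
  have hι : Function.Injective ι := IsFractionRing.injective _ _
  let j : K' →+* K' := IsFractionRing.map (genericCoeffHom_injective K n)
  have hj : ∀ a, j (ι a) = ι (genericCoeffHom K n a) := fun a ↦
    IsLocalization.map_eq _ a
  let φ (σ : Equiv.Perm (Fin n)) : K' →+* K' :=
    IsFractionRing.map (rename_injective (R := K) σ σ.injective)
  have hφ : ∀ σ a, φ σ (ι a) = ι (rename σ a) := fun σ a ↦
    IsLocalization.map_eq _ a
  have hφj : ∀ σ, (φ σ).comp j = j := fun σ ↦
    IsLocalization.ringHom_ext (nonZeroDivisors (MvPolynomial (Fin n) K)) <| RingHom.ext fun a ↦ by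
      change φ σ (j (ι a)) = j (ι a)
      rw [hj, hφ, ← AlgHom.comp_apply, rename_comp_genericCoeffHom]
  let y (i : Fin n) : K' := -ι (X i)
  have hy : Function.Injective y := fun a b hab ↦
    X_injective (hι (neg_injective hab))
  have hφy : ∀ σ i, φ σ (y i) = y (σ i) := fun σ i ↦ by
    simp only [y, map_neg, hφ, rename_X]
  have hpy : p.map j = ∏ i, (Polynomial.X - Polynomial.C (y i)) := by
    have h := congrArg (Polynomial.map ι) (X_pow_add_sum_esymm_eq_prod K n)
    simp only [Polynomial.map_add, Polynomial.map_pow, Polynomial.map_X, Polynomial.map_sum,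
      Polynomial.map_mul, Polynomial.map_C, Polynomial.map_prod] at h
    simp only [y, map_neg, sub_neg_eq_add, ← h, hpdef, Polynomial.map_add, Polynomial.map_pow,
      Polynomial.map_X, Polynomial.map_sum, Polynomial.map_mul, Polynomial.map_C]
    congr! 4 with i
    exact (hj _).trans (by simp only [genericCoeffHom, aeval_X])
  have hp : p.Monic := by
    rw [j.injective.monic_map_iff, hpy]
    exact Polynomial.monic_prod_of_monic _ _ fun i _ ↦ Polynomial.monic_X_sub_C _
  let i₀ : Fin n := ⟨0, hn⟩
  have hirr : Irreducible p := irreducible_of_transitive_roots hp j hy hpy i₀ fun i ↦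
    ⟨φ (Equiv.swap i₀ i), hφj _, by rw [hφy, Equiv.swap_apply_left]⟩
  exact ⟨hirr, subalgebra_adjoinRoot_eq_bot_or_eq_top hirr j hy hpy i₀ fun i k hi hk ↦
    ⟨φ (Equiv.swap i k), hφj _, by rw [hφy, Equiv.swap_apply_of_ne_of_ne hi.symm hk.symm],
      by rw [hφy, Equiv.swap_apply_left]⟩⟩

/-- Over `K' = K(X_0, …, X_{n-1})`, the generic monic polynomial
`p = T^n + X_{n-1} T^{n-1} + … + X_1 T + X_0` is irreducible, and the `K'`-algebra
`A' = K'[T]/(p)` has no `K'`-subalgebras other than `K'` and `A'`. -/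
theorem stmt_7 (K : Type*) [Field K] (n : ℕ) (hn : 1 ≤ n) :
    let K' := FractionRing (MvPolynomial (Fin n) K)
    let p : Polynomial K' := Polynomial.X ^ n +
      ∑ i : Fin n, Polynomial.C
        (algebraMap (MvPolynomial (Fin n) K) K' (MvPolynomial.X i)) *
          Polynomial.X ^ (i : ℕ)
    Irreducible p ∧ ∀ S : Subalgebra K' (AdjoinRoot p), S = ⊥ ∨ S = ⊤ := by
  exact irreducible_and_subalgebra_of_generic K n hn _ _ rfl
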